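/- Let N ∈ ℕ, d ∈ {0,…,N} and E ⊆ {0,…,N}. Then L̄_{N,d}(E) = E if and only if T_{N,|E|-d} ⊆ E, where T_{N,i} is taken to be ∅ when i ≤ 0. -/

import Mathlib

open MvPolynomial

noncomputable section

namespace CoveringSymmetric

/-- `N = ∑ᵢ (kᵢ - 1)` for the uniform grid `[0,k₁-1] × ⋯ × [0,kₙ-1]`. -/
def Ntot (n : ℕ) (k : Fin n → ℕ) : ℕ := ∑ i, (k i - 1)

/-- The integer points of the uniform grid `G = [0,k₁-1] × ⋯ × [0,kₙ-1]`. -/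
def gridSet (n : ℕ) (k : Fin n → ℕ) : Set (Fin n → ℕ) := {x | ∀ i, x i < k i}

/-- The real point of `ℝⁿ` corresponding to an integer point. -/
def toR {n : ℕ} (x : Fin n → ℕ) : Fin n → ℝ := fun i => (x i : ℝ)

/-- The weight `wt(x) = ∑ᵢ xᵢ` of a point. -/
def wt {n : ℕ} (x : Fin n → ℕ) : ℕ := ∑ i, x i

/-- The weight-determined set `E̲ = {x ∈ G : wt(x) ∈ E}`. -/
def wdSet (n : ℕ) (k : Fin n → ℕ) (E : Finset ℕ) : Set (Fin n → ℕ) :=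
  {x ∈ gridSet n k | wt x ∈ E}

/-- The layer `j̲ = {x ∈ G : wt(x) = j}`. -/
def layer (n : ℕ) (k : Fin n → ℕ) (j : ℕ) : Set (Fin n → ℕ) :=
  {x ∈ gridSet n k | wt x = j}

/-- The grid is strictly unimodal (SU²):
`|0̲| < ⋯ < |⌊N/2⌋̲| = |⌈N/2⌉̲| > ⋯ > |N̲|`. -/
def SU2 (n : ℕ) (k : Fin n → ℕ) : Prop :=
  (∀ j, j < Ntot n k / 2 → (layer n k j).ncard < (layer n k (j + 1)).ncard) ∧
  (layer n k (Ntot n k / 2)).ncard = (layer n k ((Ntot n k + 1) / 2)).ncard ∧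
  (∀ j, (Ntot n k + 1) / 2 ≤ j → j < Ntot n k →
    (layer n k (j + 1)).ncard < (layer n k j).ncard)

/-- The zero set `Z_G(P)` of a polynomial within the grid. -/
def ZG (n : ℕ) (k : Fin n → ℕ) (P : MvPolynomial (Fin n) ℝ) : Set (Fin n → ℕ) :=
  {x ∈ gridSet n k | eval (toR x) P = 0}

/-- The degree-`d` Zariski closure of `S ⊆ G` within the grid. -/
def Zcl (n : ℕ) (k : Fin n → ℕ) (d : ℕ) (S : Set (Fin n → ℕ)) : Set (Fin n → ℕ) :=
  {a ∈ gridSet n k | ∀ P : MvPolynomial (Fin n) ℝ, P.totalDegree ≤ d →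
    (∀ x ∈ S, eval (toR x) P = 0) → eval (toR a) P = 0}

/-- The degree-`d` Z*-closure of a weight-determined set, as a set of weights:
`{j ∈ [0,N] : j̲ ⊆ Z-cl_{G,d}(E̲)}`. -/
def Zstar (n : ℕ) (k : Fin n → ℕ) (d : ℕ) (E : Finset ℕ) : Set ℕ :=
  {j | j ≤ Ntot n k ∧ layer n k j ⊆ Zcl n k d (wdSet n k E)}

/-- `PC_G(E)`: minimum total degree of a nontrivial polynomial cover of `E̲`. -/
def PC (n : ℕ) (k : Fin n → ℕ) (E : Finset ℕ) : ℕ :=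
  sInf {d | ∃ P : MvPolynomial (Fin n) ℝ, P.totalDegree = d ∧
    wdSet n k E ⊆ ZG n k P ∧ ZG n k P ≠ gridSet n k}

/-- `PPC_G(E)`: minimum total degree of a proper polynomial cover of `E̲`. -/
def PPC (n : ℕ) (k : Fin n → ℕ) (E : Finset ℕ) : ℕ :=
  sInf {d | ∃ P : MvPolynomial (Fin n) ℝ, P.totalDegree = d ∧
    wdSet n k E ⊆ ZG n k P ∧
    ∀ j ≤ Ntot n k, j ∉ E → ¬ (layer n k j ⊆ ZG n k P)}

/-- `EPC_G(E)`: minimum total degree of an exact polynomial cover of `E̲`. -/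
def EPC (n : ℕ) (k : Fin n → ℕ) (E : Finset ℕ) : ℕ :=
  sInf {d | ∃ P : MvPolynomial (Fin n) ℝ, P.totalDegree = d ∧ ZG n k P = wdSet n k E}

/-- `x` lies on the affine hyperplane `{y ∈ ℝⁿ : ∑ᵢ wᵢ yᵢ = c}` (with `w ≠ 0`). -/
def onHyp {n : ℕ} (w : Fin n → ℝ) (c : ℝ) (x : Fin n → ℕ) : Prop :=
  ∑ i, w i * (x i : ℝ) = c

/-- `HC_G(E)`: minimum size of a nontrivial hyperplane cover of `E̲`. -/
def HC (n : ℕ) (k : Fin n → ℕ) (E : Finset ℕ) : ℕ :=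
  sInf {m | ∃ (w : Fin m → Fin n → ℝ) (c : Fin m → ℝ), (∀ t, w t ≠ 0) ∧
    (∀ x ∈ wdSet n k E, ∃ t, onHyp (w t) (c t) x) ∧
    ∃ x ∈ gridSet n k, ∀ t, ¬ onHyp (w t) (c t) x}

/-- `PHC_G(E)`: minimum size of a proper hyperplane cover of `E̲`. -/
def PHC (n : ℕ) (k : Fin n → ℕ) (E : Finset ℕ) : ℕ :=
  sInf {m | ∃ (w : Fin m → Fin n → ℝ) (c : Fin m → ℝ), (∀ t, w t ≠ 0) ∧
    (∀ x ∈ wdSet n k E, ∃ t, onHyp (w t) (c t) x) ∧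
    ∀ j ≤ Ntot n k, j ∉ E → ¬ (layer n k j ⊆ {x | ∃ t, onHyp (w t) (c t) x})}

/-- The certifying degree of `S ⊆ G`: least `d ∈ [0,N]` such that some polynomial of
total degree at most `d` is nonconstant on `G` but constant on `S`. -/
def certDeg (n : ℕ) (k : Fin n → ℕ) (S : Set (Fin n → ℕ)) : ℕ :=
  sInf {d | d ≤ Ntot n k ∧ ∃ f : MvPolynomial (Fin n) ℝ, f.totalDegree ≤ d ∧
    (∃ a ∈ gridSet n k, ∃ b ∈ gridSet n k, eval (toR a) f ≠ eval (toR b) f) ∧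
    ∀ a ∈ S, ∀ b ∈ S, eval (toR a) f = eval (toR b) f}

/-- `T_{N,i} = [0,i-1] ∪ [N-i+1,N]` (so `T_{N,0} = ∅`). -/
def T (N i : ℕ) : Finset ℕ := Finset.range i ∪ Finset.Icc (N - i + 1) N

/-- `E` is `(d,i)`-admitting: `E ∪ T_{N,i} ≠ [0,N]` and `|E \ T_{N,i}| ≤ d - i`. -/
def Admitting (N d i : ℕ) (E : Finset ℕ) : Prop :=
  E ∪ T N i ≠ Finset.range (N + 1) ∧ (E \ T N i).card ≤ d - i

/-- `E` is `d`-admitting: `(d,i)`-admitting for some `i ∈ [0,d]`. -/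
def DAdmitting (N d : ℕ) (E : Finset ℕ) : Prop :=
  ∃ i ≤ d, Admitting N d i E

/-- The operator `L_{N,d}`: if `E = {t₁ < ⋯ < t_s}` with `s ≥ d+1`, then
`L_{N,d}(E) = [0, t_{s-d}] ∪ E ∪ [t_{d+1}, N]`, and `L_{N,d}(E) = E` if `s ≤ d`.
(For `E ⊆ [0,N]`, `j ≤ t_{s-d}` iff `E` has at least `d+1` elements `≥ j`, and
`t_{d+1} ≤ j` iff `E` has at least `d+1` elements `≤ j`.) -/
def Lop (N d : ℕ) (E : Finset ℕ) : Finset ℕ :=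
  E ∪ (Finset.range (N + 1)).filter fun j =>
    d + 1 ≤ (E.filter fun t => j ≤ t).card ∨ d + 1 ≤ (E.filter fun t => t ≤ j).card

/-- `L̄_{N,d}(E) = ⋃ₘ L_{N,d}^m(E)`, the union of all iterates of `L_{N,d}` on `E`. -/
def Lbar (N d : ℕ) (E : Finset ℕ) : Set ℕ :=
  ⋃ m : ℕ, ((Lop N d)^[m] E : Set ℕ)

/-- `P` is a (possibly empty) product of polynomials of total degree at most 1. -/
def ProdLinear (n : ℕ) (P : MvPolynomial (Fin n) ℝ) : Prop :=
  ∃ (m : ℕ) (ℓ : Fin m → MvPolynomial (Fin n) ℝ),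
    (∀ t, (ℓ t).totalDegree ≤ 1) ∧ P = ∏ t, ℓ t

/-- The degree-`d` h-closure of `S ⊆ G`. -/
def hcl (n : ℕ) (k : Fin n → ℕ) (d : ℕ) (S : Set (Fin n → ℕ)) : Set (Fin n → ℕ) :=
  {a ∈ gridSet n k | ∀ P : MvPolynomial (Fin n) ℝ, ProdLinear n P → P.totalDegree ≤ d →
    (∀ x ∈ S, eval (toR x) P = 0) → eval (toR a) P = 0}

theorem subset_Lop (N d : ℕ) (E : Finset ℕ) : E ⊆ Lop N d E :=
  Finset.subset_union_left

theorem Lbar_eq_iff (N d : ℕ) (E : Finset ℕ) : Lbar N d E = ↑E ↔ Lop N d E = E := by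
  constructor
  · intro h
    refine Finset.Subset.antisymm ?_ (subset_Lop N d E)
    rw [← Finset.coe_subset, ← h]
    exact Set.subset_iUnion (fun m => ((Lop N d)^[m] E : Set ℕ)) 1
  · intro h
    simp [Lbar, Function.iterate_fixed h, Set.iUnion_const]

theorem Lop_eq_self_iff (N d : ℕ) (E : Finset ℕ) :
    Lop N d E = E ↔ ∀ j ≤ N, d + 1 ≤ (E.filter fun t => j ≤ t).card ∨
      d + 1 ≤ (E.filter fun t => t ≤ j).card → j ∈ E := by
  rw [Lop, Finset.union_eq_left, Finset.subset_iff]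
  simp only [Finset.mem_filter, Finset.mem_range, Nat.lt_succ_iff, and_imp]

theorem card_filter_ge_add_card_filter_lt (E : Finset ℕ) (j : ℕ) :
    (E.filter fun t => j ≤ t).card + (E.filter fun t => t < j).card = E.card := by
  simpa only [not_le] using Finset.card_filter_add_card_filter_not (s := E) (fun t => j ≤ t)

theorem card_filter_le_add_card_filter_gt (E : Finset ℕ) (j : ℕ) :
    (E.filter fun t => t ≤ j).card + (E.filter fun t => j < t).card = E.card := by
  simpa only [not_le] using Finset.card_filter_add_card_filter_not (s := E) (fun t => t ≤ j)

theorem T_subset_of_Lop_eq_self {N d : ℕ} {E : Finset ℕ} (hE : E ⊆ Finset.range (N + 1))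
    (h : Lop N d E = E) : T N (E.card - d) ⊆ E := by
  rw [Lop_eq_self_iff] at h
  have hcard : E.card ≤ N + 1 := by simpa using Finset.card_le_card hE
  refine Finset.union_subset (fun j hj => ?_) (fun j hj => ?_)
  · rw [Finset.mem_range] at hj
    refine h j (by omega) (Or.inl ?_)
    have hlt : (E.filter fun t => t < j).card ≤ (Finset.range j).card :=
      Finset.card_le_card fun t ht => Finset.mem_range.2 (Finset.mem_filter.1 ht).2
    have := card_filter_ge_add_card_filter_lt E j
    rw [Finset.card_range] at hlt
    omega
  · rw [Finset.mem_Icc] at hj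
    refine h j hj.2 (Or.inr ?_)
    have hgt : (E.filter fun t => j < t).card ≤ (Finset.Ioc j N).card :=
      Finset.card_le_card fun t ht => by
        rw [Finset.mem_filter] at ht
        exact Finset.mem_Ioc.2 ⟨ht.2, Nat.lt_succ_iff.1 (Finset.mem_range.1 (hE ht.1))⟩
    have := card_filter_le_add_card_filter_gt E j
    rw [Nat.card_Ioc] at hgt
    omega

theorem Lop_eq_self_of_T_subset {N d : ℕ} {E : Finset ℕ}
    (h : T N (E.card - d) ⊆ E) : Lop N d E = E := by
  rw [Lop_eq_self_iff]
  have hlow : Finset.range (E.card - d) ⊆ E := Finset.subset_union_left.trans h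
  have hhigh : Finset.Icc (N - (E.card - d) + 1) N ⊆ E := Finset.subset_union_right.trans h
  intro j hj hcard
  by_contra hjE
  have hj₁ : E.card - d ≤ j := by
    by_contra hlt
    exact hjE (hlow (Finset.mem_range.2 (by omega)))
  have hj₂ : j ≤ N - (E.card - d) := by
    by_contra hlt
    exact hjE (hhigh (Finset.mem_Icc.2 ⟨by omega, hj⟩))
  rcases hcard with hge | hle
  · have hlt : (Finset.range (E.card - d)).card ≤ (E.filter fun t => t < j).card :=
      Finset.card_le_card fun t ht => Finset.mem_filter.2
        ⟨hlow ht, (Finset.mem_range.1 ht).trans_le hj₁⟩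
    have := card_filter_ge_add_card_filter_lt E j
    rw [Finset.card_range] at hlt
    omega
  · have hgt : (Finset.Icc (N - (E.card - d) + 1) N).card ≤ (E.filter fun t => j < t).card :=
      Finset.card_le_card fun t ht => Finset.mem_filter.2
        ⟨hhigh ht, Nat.lt_of_lt_of_le (Nat.lt_succ_of_le hj₂) (Finset.mem_Icc.1 ht).1⟩
    have := card_filter_le_add_card_filter_gt E j
    rw [Nat.card_Icc] at hgt
    omega

/-- `L̄_{N,d}(E) = E` iff `T_{N,|E|-d} ⊆ E`. -/
theorem stmt7 (N d : ℕ) (hd : d ≤ N) (E : Finset ℕ) (hE : E ⊆ Finset.range (N + 1)) :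
    Lbar N d E = ↑E ↔ T N (E.card - d) ⊆ E := by
  rw [Lbar_eq_iff]
  exact ⟨T_subset_of_Lop_eq_self hE, Lop_eq_self_of_T_subset⟩

end CoveringSymmetric
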